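/- Assume d_1 ≥ 0. Let D* = max_{x∈X} s*(x) (which exists since s* takes finitely many values) and Δ = sup{ L(x, max{s*(x), s}) − L(x, s*(x)) : x ∈ X, s ∈ ℤ, s ≤ D* − d_1 }. Then Δ is finite, and for every n ≥ 0, every x ∈ X, and every integer s ≤ D* − d_1: v^U_n(x,s) − v^L_n(x) ≤ (1 + β + β² + ⋯ + β^{n−1}) Δ ≤ Δ/(1−β). -/

import Mathlib

open Finset

noncomputable section

open scoped Classical

namespace InvCtrl

variable {N M : ℕ} {Z : Type*}

/-- Membership in the belief space `X ⊆ ℝ^N`. -/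
def memX (N : ℕ) (x : Fin N → ℝ) : Prop :=
  (∀ i, 0 ≤ x i) ∧ ∑ i, x i = 1

variable [Fintype Z]

/-- `σ(d_k, z, x) = x ⬝ P(d_k, z) ⬝ 𝟙`. -/
def sigz (P : Fin M → Z → Matrix (Fin N) (Fin N) ℝ) (k : Fin M) (z : Z) (x : Fin N → ℝ) : ℝ :=
  ∑ i, x i * ∑ j, P k z i j

/-- `σ(d_k, x) = ∑_z σ(d_k, z, x)`. -/
def sig (P : Fin M → Z → Matrix (Fin N) (Fin N) ℝ) (k : Fin M) (x : Fin N → ℝ) : ℝ :=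
  ∑ z, sigz P k z x

/-- Posterior belief `λ(d_k, z, x) = x P(d_k, z) / σ(d_k, z, x)` (componentwise). -/
def lam (P : Fin M → Z → Matrix (Fin N) (Fin N) ℝ) (k : Fin M) (z : Z) (x : Fin N → ℝ) :
    Fin N → ℝ :=
  fun j => (∑ i, x i * P k z i j) / sigz P k z x

/-- Single-period cost `c(y, d) = p·(d − y)⁺ + h·(y − d)⁺`. -/
def cst (p hc y dd : ℝ) : ℝ := p * max (dd - y) 0 + hc * max (y - dd) 0

/-- Expected single-period cost `L(x, y) = ∑_k σ(d_k, x) c(y, d_k)`. -/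
def Lf (P : Fin M → Z → Matrix (Fin N) (Fin N) ℝ) (d : Fin M → ℤ) (p hc : ℝ)
    (x : Fin N → ℝ) (y : ℝ) : ℝ :=
  ∑ k, sig P k x * cst p hc y (d k : ℝ)

/-- `s*(x)`: the smallest element of `{d_1, …, d_M}` at which `m ↦ L(x, d_m)` is minimized. -/
def sStar (P : Fin M → Z → Matrix (Fin N) (Fin N) ℝ) (d : Fin M → ℤ) (p hc : ℝ)
    (x : Fin N → ℝ) : ℤ :=
  sInf {t : ℤ | ∃ m : Fin M, t = d m ∧ ∀ k : Fin M, Lf P d p hc x (d m : ℝ) ≤ Lf P d p hc x (d k : ℝ)}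

/-- First-order stochastic dominance `x ⪯ x'`. -/
def sdom (x x' : Fin N → ℝ) : Prop :=
  ∀ n : Fin N, ∑ i ∈ univ.filter (fun i => n ≤ i), x i ≤ ∑ i ∈ univ.filter (fun i => n ≤ i), x' i

/-- The `i`-th standard unit vector in `ℝ^N`. -/
def eV (N : ℕ) (i : Fin N) : Fin N → ℝ := fun j => if j = i then 1 else 0

/-- Assumption A3. -/
def A3 (P : Fin M → Z → Matrix (Fin N) (Fin N) ℝ) : Prop :=
  ∀ i i' : Fin N, i ≤ i' → ∀ m : Fin M,
    ∑ k ∈ univ.filter (fun k : Fin M => m ≤ k), ∑ j, ∑ z, P k z i j ≤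
      ∑ k ∈ univ.filter (fun k : Fin M => m ≤ k), ∑ j, ∑ z, P k z i' j

/-- `A_m(x) = h ∑_{k=1}^m σ(d_k,x) − p ∑_{k=m+1}^M σ(d_k,x)` (for `m = 0, …, M`). -/
def Am (P : Fin M → Z → Matrix (Fin N) (Fin N) ℝ) (p hc : ℝ) (m : ℕ) (x : Fin N → ℝ) : ℝ :=
  hc * ∑ k ∈ univ.filter (fun k : Fin M => (k : ℕ) < m), sig P k x
    - p * ∑ k ∈ univ.filter (fun k : Fin M => m ≤ (k : ℕ)), sig P k x

/-- `B_m(x) = p ∑_{k=m+1}^M d_k σ(d_k,x) − h ∑_{k=1}^m d_k σ(d_k,x)` (for `m = 0, …, M`). -/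
def Bm (P : Fin M → Z → Matrix (Fin N) (Fin N) ℝ) (d : Fin M → ℤ) (p hc : ℝ) (m : ℕ)
    (x : Fin N → ℝ) : ℝ :=
  p * ∑ k ∈ univ.filter (fun k : Fin M => m ≤ (k : ℕ)), (d k : ℝ) * sig P k x
    - hc * ∑ k ∈ univ.filter (fun k : Fin M => (k : ℕ) < m), (d k : ℝ) * sig P k x

/-- Finite-horizon value iteration: `v_0 = 0` and
`v_{n+1}(x,s) = inf_{y ≥ s, y ∈ ℤ} [ L(x,y) + β ∑_{(d_k,z) : σ(d_k,z,x) ≠ 0} σ(d_k,z,x)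
v_n(λ(d_k,z,x), f(y,d_k)) ]`, for a general transition `f` of the inventory position. -/
def vIter (P : Fin M → Z → Matrix (Fin N) (Fin N) ℝ) (d : Fin M → ℤ) (p hc β : ℝ)
    (f : ℤ → ℤ → ℤ) : ℕ → (Fin N → ℝ) → ℤ → ℝ
  | 0, _, _ => 0
  | n + 1, x, s =>
    sInf {r : ℝ | ∃ y : ℤ, s ≤ y ∧
      r = Lf P d p hc x (y : ℝ) + β * ∑ k, ∑ z,
        (if sigz P k z x = 0 then 0
         else sigz P k z x * vIter P d p hc β f n (lam P k z x) (f y (d k)))}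

/-- The lower-bound iteration: `v^L_0 = 0` and
`v^L_{n+1}(x) = L(x, s*(x)) + β ∑_{(d_k,z) : σ ≠ 0} σ(d_k,z,x) v^L_n(λ(d_k,z,x))`. -/
def vLow (P : Fin M → Z → Matrix (Fin N) (Fin N) ℝ) (d : Fin M → ℤ) (p hc β : ℝ) :
    ℕ → (Fin N → ℝ) → ℝ
  | 0, _ => 0
  | n + 1, x =>
    Lf P d p hc x ((sStar P d p hc x : ℤ) : ℝ) + β * ∑ k, ∑ z,
      (if sigz P k z x = 0 then 0
       else sigz P k z x * vLow P d p hc β n (lam P k z x))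

/-- The upper-bound iteration (cost of the myopic "order up to `max{s*(x),s}`" policy):
`v^U_0 = 0` and, with `y(x,s) = max{s*(x),s}`,
`v^U_{n+1}(x,s) = L(x,y(x,s)) + β ∑_{(d_k,z) : σ ≠ 0} σ(d_k,z,x)
v^U_n(λ(d_k,z,x), y(x,s) − d_k)`. -/
def vUp (P : Fin M → Z → Matrix (Fin N) (Fin N) ℝ) (d : Fin M → ℤ) (p hc β : ℝ) :
    ℕ → (Fin N → ℝ) → ℤ → ℝ
  | 0, _, _ => 0
  | n + 1, x, s =>
    Lf P d p hc x ((max (sStar P d p hc x) s : ℤ) : ℝ) + β * ∑ k, ∑ z,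
      (if sigz P k z x = 0 then 0
       else sigz P k z x * vUp P d p hc β n (lam P k z x) (max (sStar P d p hc x) s - d k))

lemma sigz_nonneg (P : Fin M → Z → Matrix (Fin N) (Fin N) ℝ)
    (hPnn : ∀ k z i j, 0 ≤ P k z i j) (k : Fin M) (z : Z) (x : Fin N → ℝ) (hx : memX N x) :
    0 ≤ sigz P k z x :=
  Finset.sum_nonneg fun i _ => mul_nonneg (hx.1 i) (Finset.sum_nonneg fun j _ => hPnn k z i j)

lemma sigz_sum (P : Fin M → Z → Matrix (Fin N) (Fin N) ℝ)
    (hPst : ∀ i : Fin N, ∑ k : Fin M, ∑ z : Z, ∑ j : Fin N, P k z i j = 1)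
    (x : Fin N → ℝ) (hx : memX N x) : ∑ k, ∑ z, sigz P k z x = 1 := by
  unfold sigz
  have h1 : ∀ k : Fin M, ∑ z, ∑ i, x i * ∑ j, P k z i j = ∑ i, x i * ∑ z, ∑ j, P k z i j := by
    intro k
    rw [Finset.sum_comm]
    simp only [Finset.mul_sum]
  simp only [h1]
  rw [Finset.sum_comm]
  simp only [← Finset.mul_sum, hPst, mul_one]
  exact hx.2

lemma lam_mem (P : Fin M → Z → Matrix (Fin N) (Fin N) ℝ)
    (hPnn : ∀ k z i j, 0 ≤ P k z i j) (k : Fin M) (z : Z) (x : Fin N → ℝ) (hx : memX N x)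
    (h : sigz P k z x ≠ 0) : memX N (lam P k z x) := by
  refine ⟨fun j => div_nonneg (Finset.sum_nonneg fun i _ => mul_nonneg (hx.1 i) (hPnn k z i j))
    (sigz_nonneg P hPnn k z x hx), ?_⟩
  unfold lam
  rw [← Finset.sum_div, Finset.sum_comm]
  simp only [← Finset.mul_sum]
  exact div_self h

lemma cst_diff (p hc y y' t : ℝ) (hp : 0 < p) (hhc : 0 < hc) (h : y' ≤ y) :
    cst p hc y t - cst p hc y' t ≤ hc * (y - y') := by
  unfold cst
  have h1 : max (t - y) 0 ≤ max (t - y') 0 := max_le_max (by linarith) le_rfl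
  have h2 : max (y - t) 0 ≤ max (y' - t) 0 + (y - y') :=
    max_le (by linarith [le_max_left (y' - t) 0]) (by linarith [le_max_right (y' - t) 0])
  have h3 := mul_le_mul_of_nonneg_left h1 hp.le
  have h4 := mul_le_mul_of_nonneg_left h2 hhc.le
  linarith

lemma Lf_diff (P : Fin M → Z → Matrix (Fin N) (Fin N) ℝ) (d : Fin M → ℤ)
    (hPnn : ∀ k z i j, 0 ≤ P k z i j)
    (hPst : ∀ i : Fin N, ∑ k : Fin M, ∑ z : Z, ∑ j : Fin N, P k z i j = 1)
    (p hc y y' : ℝ) (hp : 0 < p) (hhc : 0 < hc) (h : y' ≤ y) (x : Fin N → ℝ) (hx : memX N x) :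
    Lf P d p hc x y - Lf P d p hc x y' ≤ hc * (y - y') := by
  have hs : ∑ k, sig P k x = 1 := sigz_sum P hPst x hx
  unfold Lf
  rw [← Finset.sum_sub_distrib]
  calc _ ≤ ∑ k, sig P k x * (hc * (y - y')) := by
        refine Finset.sum_le_sum fun k _ => ?_
        rw [← mul_sub]
        exact mul_le_mul_of_nonneg_left (cst_diff p hc y y' _ hp hhc h)
          (Finset.sum_nonneg fun z _ => sigz_nonneg P hPnn k z x hx)
    _ = _ := by rw [← Finset.sum_mul, hs, one_mul]

lemma sStar_mem (P : Fin M → Z → Matrix (Fin N) (Fin N) ℝ) (d : Fin M → ℤ) (p hc : ℝ)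
    (hM : 1 ≤ M) (x : Fin N → ℝ) : ∃ m : Fin M, sStar P d p hc x = d m := by
  have : Nonempty (Fin M) := ⟨⟨0, hM⟩⟩
  obtain ⟨m, hm⟩ := Finite.exists_min (fun m : Fin M => Lf P d p hc x (d m : ℝ))
  have hne : {t : ℤ | ∃ m : Fin M, t = d m ∧
      ∀ k : Fin M, Lf P d p hc x (d m : ℝ) ≤ Lf P d p hc x (d k : ℝ)}.Nonempty :=
    ⟨d m, m, rfl, hm⟩
  have hbd : BddBelow {t : ℤ | ∃ m : Fin M, t = d m ∧
      ∀ k : Fin M, Lf P d p hc x (d m : ℝ) ≤ Lf P d p hc x (d k : ℝ)} := by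
    refine (Set.Finite.subset (Set.finite_range d) ?_).bddBelow
    rintro t ⟨m, rfl, _⟩
    exact ⟨m, rfl⟩
  obtain ⟨m', h, _⟩ := Int.csInf_mem hne hbd
  exact ⟨m', h⟩

/-- Proposition 4: with `D* = max_{x∈X} s*(x)` and
`Δ = sup { L(x, max{s*(x),s}) − L(x, s*(x)) : x ∈ X, s ≤ D* − d_1 }`, `Δ` is finite and
`v^U_n(x,s) − v^L_n(x) ≤ (1 + β + ⋯ + β^{n−1}) Δ ≤ Δ/(1−β)`. -/
theorem stmt12 {N M : ℕ} {Z : Type*} [Fintype Z] [Nonempty Z]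
    (hN : 1 ≤ N) (hM : 1 ≤ M)
    (d : Fin M → ℤ) (hd : StrictMono d) (hd1 : 0 ≤ d ⟨0, by omega⟩)
    (P : Fin M → Z → Matrix (Fin N) (Fin N) ℝ)
    (hPnn : ∀ k z i j, 0 ≤ P k z i j)
    (hPst : ∀ i : Fin N, ∑ k : Fin M, ∑ z : Z, ∑ j : Fin N, P k z i j = 1)
    (p hc : ℝ) (hp : 0 < p) (hhc : 0 < hc)
    (β : ℝ) (hβ0 : 0 ≤ β) (hβ1 : β < 1)
    (Dstar : ℤ)
    (hD : IsGreatest {t : ℤ | ∃ x : Fin N → ℝ, memX N x ∧ t = sStar P d p hc x} Dstar)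
    (Δset : Set ℝ)
    (hΔset : Δset = {r : ℝ | ∃ (x : Fin N → ℝ) (s : ℤ), memX N x ∧
      s ≤ Dstar - d ⟨0, by omega⟩ ∧
      r = Lf P d p hc x ((max (sStar P d p hc x) s : ℤ) : ℝ) -
        Lf P d p hc x ((sStar P d p hc x : ℤ) : ℝ)}) :
    Δset.Nonempty ∧ BddAbove Δset ∧
    ∀ (n : ℕ) (x : Fin N → ℝ) (s : ℤ), memX N x → s ≤ Dstar - d ⟨0, by omega⟩ →
      vUp P d p hc β n x s - vLow P d p hc β n x ≤
          (∑ i ∈ Finset.range n, β ^ i) * sSup Δset ∧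
      (∑ i ∈ Finset.range n, β ^ i) * sSup Δset ≤ sSup Δset / (1 - β) := by
  have hd0 : ∀ k, d ⟨0, by omega⟩ ≤ d k := fun k => hd.monotone (Fin.mk_le_of_le_val (Nat.zero_le _))
  obtain ⟨⟨x0, hx0, _⟩, hDub⟩ := hD
  have hsD : ∀ x, memX N x → sStar P d p hc x ≤ Dstar := fun x hx => hDub ⟨x, hx, rfl⟩
  have h0 : (0 : ℝ) ∈ Δset := by
    rw [hΔset]
    refine ⟨x0, min (Dstar - d ⟨0, by omega⟩) (sStar P d p hc x0), hx0, min_le_left _ _, ?_⟩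
    rw [max_eq_left (min_le_right _ _), sub_self]
  have hbdd : BddAbove Δset := by
    refine ⟨hc * ((Dstar : ℝ) - (d ⟨0, by omega⟩ : ℤ)), ?_⟩
    rw [hΔset]
    rintro r ⟨x, s, hx, hs, rfl⟩
    obtain ⟨m, hm⟩ := sStar_mem P d p hc hM x
    have h1 : max (sStar P d p hc x) s ≤ Dstar := max_le (hsD x hx) (by omega)
    have h2 : d ⟨0, by omega⟩ ≤ sStar P d p hc x := hm ▸ hd0 m
    have h1' : ((max (sStar P d p hc x) s : ℤ) : ℝ) ≤ Dstar := Int.cast_le.mpr h1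
    have h2' : ((d ⟨0, by omega⟩ : ℤ) : ℝ) ≤ ((sStar P d p hc x : ℤ) : ℝ) := Int.cast_le.mpr h2
    refine (Lf_diff P d hPnn hPst p hc _ _ hp hhc
      (Int.cast_le.mpr (le_max_left _ _)) x hx).trans ?_
    exact mul_le_mul_of_nonneg_left (by linarith) hhc.le
  have hΔ0 : 0 ≤ sSup Δset := le_csSup hbdd h0
  refine ⟨⟨0, h0⟩, hbdd, ?_⟩
  intro n x s hx hs
  constructor
  · induction n generalizing x s with
    | zero => simp [vUp, vLow]
    | succ n ih =>
      have hy : max (sStar P d p hc x) s ≤ Dstar := max_le (hsD x hx) (by omega)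
      have hL : Lf P d p hc x ((max (sStar P d p hc x) s : ℤ) : ℝ) -
          Lf P d p hc x ((sStar P d p hc x : ℤ) : ℝ) ≤ sSup Δset :=
        le_csSup hbdd (by rw [hΔset]; exact ⟨x, s, hx, hs, rfl⟩)
      rw [geom_sum_succ]
      simp only [vUp, vLow]
      set G := (∑ i ∈ Finset.range n, β ^ i) * sSup Δset with hG
      have hS : (∑ k, ∑ z, (if sigz P k z x = 0 then 0
          else sigz P k z x * vUp P d p hc β n (lam P k z x) (max (sStar P d p hc x) s - d k))) -
          (∑ k, ∑ z, (if sigz P k z x = 0 then 0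
          else sigz P k z x * vLow P d p hc β n (lam P k z x))) ≤ G := by
        calc _ ≤ ∑ k, ∑ z, sigz P k z x * G := by
              rw [← Finset.sum_sub_distrib]
              refine Finset.sum_le_sum fun k _ => ?_
              rw [← Finset.sum_sub_distrib]
              refine Finset.sum_le_sum fun z _ => ?_
              split_ifs with h
              · simp [h]
              · rw [← mul_sub]
                refine mul_le_mul_of_nonneg_left ?_ (sigz_nonneg P hPnn k z x hx)
                exact ih _ _ (lam_mem P hPnn k z x hx h) (by have := hd0 k; omega)
          _ = G := by
              simp only [← Finset.sum_mul]
              rw [sigz_sum P hPst x hx, one_mul]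
      have hS' := mul_le_mul_of_nonneg_left hS hβ0
      have : (β * ∑ i ∈ Finset.range n, β ^ i + 1) * sSup Δset = β * G + sSup Δset := by
        rw [hG]; ring
      rw [this]
      linarith
  · have hg : (∑ i ∈ Finset.range n, β ^ i) * (1 - β) ≤ 1 := by
      rw [geom_sum_mul_neg]
      linarith [pow_nonneg hβ0 n]
    rw [le_div_iff₀ (by linarith)]
    nlinarith

end InvCtrl
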